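/- Let d : ℤ × ℤ → ℂ satisfy, for all n, m ∈ ℤ: the recursions d(n+1,m) = 2·d(n,m) − d(n−1,m) and d(n,m+1) = 2·d(n,m) − d(n,m−1) together with d(n+1,m) − d(n,m) = d(n+1,m−1) − d(n,m−1) and d(n,m+1) − d(n,m) = d(n−1,m+1) − d(n−1,m), and additionally conj(d(n,m)) = −d(−n,−m) and conj(d(n,m)) = d(n,m) for all n, m. Then there exist real numbers τ₁, τ₂ such that d(n,m) = τ₁·n + τ₂·m for all n, m ∈ ℤ. -/

import Mathlib

theorem eq_apply_zero_of_apply_add_one_eq {α : Type*} {f : ℤ → α} (hf : ∀ n, f (n + 1) = f n)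
    (n : ℤ) : f n = f 0 := by
  have hp : Function.Periodic f 1 := hf
  simpa using hp.int_mul_eq n

/-- A two-sided sequence with vanishing second differences is affine. -/
theorem eq_affine_of_second_difference_eq_zero {R : Type*} [CommRing R] {f : ℤ → R}
    (hf : ∀ n, f (n + 1) = 2 * f n - f (n - 1)) (n : ℤ) :
    f n = f 0 + n * (f 1 - f 0) := by
  have hdiff : ∀ k, f (k + 1) - f k = f 1 - f 0 := by
    intro k
    simpa using eq_apply_zero_of_apply_add_one_eq (f := fun k => f (k + 1) - f k)
      (fun k => by
        have h := hf (k + 1)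
        rw [add_sub_cancel_right] at h
        linear_combination h) k
  have h := eq_apply_zero_of_apply_add_one_eq (f := fun k : ℤ => f k - k * (f 1 - f 0))
    (fun k => by
      push_cast
      linear_combination hdiff k) n
  simp only [Int.cast_zero, zero_mul, sub_zero] at h
  linear_combination h

/-- Full classification of equivariant Dirac coefficients on the
noncommutative torus: the order-one recursions together with the reality
condition `conj (d(n,m)) = −d(−n,−m)` and `β`-selfadjointness
`conj (d(n,m)) = d(n,m)` force `d(n,m) = τ₁ n + τ₂ m` with real `τ₁, τ₂`. -/
theorem stmt_15 (d : ℤ × ℤ → ℂ)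
    (h1 : ∀ n m : ℤ, d (n + 1, m) = 2 * d (n, m) - d (n - 1, m))
    (h4 : ∀ n m : ℤ, d (n, m + 1) = 2 * d (n, m) - d (n, m - 1))
    (h2 : ∀ n m : ℤ, d (n + 1, m) - d (n, m) = d (n + 1, m - 1) - d (n, m - 1))
    (h3 : ∀ n m : ℤ, d (n, m + 1) - d (n, m) = d (n - 1, m + 1) - d (n - 1, m))
    (hJ : ∀ n m : ℤ, starRingEnd ℂ (d (n, m)) = - d (-n, -m))
    (hβ : ∀ n m : ℤ, starRingEnd ℂ (d (n, m)) = d (n, m)) :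
    ∃ τ₁ τ₂ : ℝ, ∀ n m : ℤ, d (n, m) = (τ₁ : ℂ) * n + (τ₂ : ℂ) * m := by
  have h00 : d (0, 0) = 0 := by
    have h := hJ 0 0
    rw [hβ, neg_zero] at h
    exact self_eq_neg.mp h
  have hrow : ∀ m : ℤ, d (1, m) - d (0, m) = d (1, 0) - d (0, 0) :=
    eq_apply_zero_of_apply_add_one_eq (f := fun m => d (1, m) - d (0, m))
      (fun m => by simpa using h2 0 (m + 1))
  refine ⟨(d (1, 0)).re, (d (0, 1)).re, fun n m => ?_⟩
  rw [Complex.conj_eq_iff_re.mp (hβ 1 0), Complex.conj_eq_iff_re.mp (hβ 0 1)]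
  have hn := eq_affine_of_second_difference_eq_zero (f := fun k => d (k, m)) (h1 · m) n
  have hm := eq_affine_of_second_difference_eq_zero (f := fun k => d (0, k)) (h4 0) m
  simp only [hrow, h00, sub_zero, zero_add] at hn hm
  rw [hn, hm]
  ring
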